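/- Let K_out : ℝ² \ {0} → ℝ² be defined by K_out(y) = (y^⊥ / (2π|y|³)) · (1 − e^{−|y|²}), where y^⊥ = (−y₂, y₁). Then there exists a universal constant C_K ≥ 1 such that for every multi-index α ∈ ℕ₀² and every y ≠ 0, |∂^α K_out(y)| ≤ C_K^{|α|} · |α|! / |y|^{|α|}. -/

import Mathlib

/-- Euclidean norm on `ℝ²` (represented as `ℝ × ℝ`). -/
noncomputable def nrm (y : ℝ × ℝ) : ℝ := Real.sqrt (y.1 ^ 2 + y.2 ^ 2)

/-- Partial derivative in the first variable. -/
noncomputable def pd1 (f : ℝ × ℝ → ℝ) : ℝ × ℝ → ℝ :=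
  fun y => deriv (fun s => f (s, y.2)) y.1

/-- Partial derivative in the second variable. -/
noncomputable def pd2 (f : ℝ × ℝ → ℝ) : ℝ × ℝ → ℝ :=
  fun y => deriv (fun s => f (y.1, s)) y.2

/-- The iterated partial derivative `∂^α = ∂_{y_1}^{α₁} ∂_{y_2}^{α₂}`. -/
noncomputable def pdMulti (α₁ α₂ : ℕ) (f : ℝ × ℝ → ℝ) : ℝ × ℝ → ℝ :=
  (pd1)^[α₁] ((pd2)^[α₂] f)

/-- First component of `K_out(y) = (y^⊥/(2π|y|³))·(1 − e^{−|y|²})`, with `y^⊥ = (−y₂, y₁)`. -/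
noncomputable def Kout1 (y : ℝ × ℝ) : ℝ :=
  -y.2 / (2 * Real.pi * nrm y ^ 3) * (1 - Real.exp (-(nrm y ^ 2)))

/-- Second component of `K_out(y) = (y^⊥/(2π|y|³))·(1 − e^{−|y|²})`. -/
noncomputable def Kout2 (y : ℝ × ℝ) : ℝ :=
  y.1 / (2 * Real.pi * nrm y ^ 3) * (1 - Real.exp (-(nrm y ^ 2)))

/-- Complex partial derivative in the first variable. -/
noncomputable def cpd1 (F : ℂ × ℂ → ℂ) : ℂ × ℂ → ℂ :=
  fun z => deriv (fun s => F (s, z.2)) z.1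

/-- Complex partial derivative in the second variable. -/
noncomputable def cpd2 (F : ℂ × ℂ → ℂ) : ℂ × ℂ → ℂ :=
  fun z => deriv (fun s => F (z.1, s)) z.2

theorem iterate_cpd1 (n : ℕ) (F : ℂ × ℂ → ℂ) (z : ℂ × ℂ) :
    cpd1^[n] F z = iteratedDeriv n (fun s => F (s, z.2)) z.1 := by
  induction n generalizing z with
  | zero => simp
  | succ n ih =>
    rw [Function.iterate_succ_apply', iteratedDeriv_succ]
    simp only [cpd1]
    congr 1
    funext s
    exact ih (s, z.2)

theorem iterate_cpd2 (n : ℕ) (F : ℂ × ℂ → ℂ) (z : ℂ × ℂ) :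
    cpd2^[n] F z = iteratedDeriv n (fun s => F (z.1, s)) z.2 := by
  induction n generalizing z with
  | zero => simp
  | succ n ih =>
    rw [Function.iterate_succ_apply', iteratedDeriv_succ]
    simp only [cpd2]
    congr 1
    funext s
    exact ih (z.1, s)

theorem hasDerivAt_cpd1 {F : ℂ × ℂ → ℂ} {z : ℂ × ℂ} (h : DifferentiableAt ℂ F z) :
    HasDerivAt (fun s => F (s, z.2)) (fderiv ℂ F z (1, 0)) z.1 :=
  h.hasFDerivAt.comp_hasDerivAt z.1 ((hasDerivAt_id z.1).prodMk (hasDerivAt_const z.1 z.2))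

theorem hasDerivAt_cpd2 {F : ℂ × ℂ → ℂ} {z : ℂ × ℂ} (h : DifferentiableAt ℂ F z) :
    HasDerivAt (fun s => F (z.1, s)) (fderiv ℂ F z (0, 1)) z.2 :=
  h.hasFDerivAt.comp_hasDerivAt z.2 ((hasDerivAt_const z.2 z.1).prodMk (hasDerivAt_id z.2))

theorem AnalyticOnNhd.cpd1 {F : ℂ × ℂ → ℂ} {U : Set (ℂ × ℂ)} (hU : IsOpen U)
    (hF : AnalyticOnNhd ℂ F U) : AnalyticOnNhd ℂ (cpd1 F) U := by
  have h : AnalyticOnNhd ℂ (fun z => fderiv ℂ F z (1, 0)) U := fun z hz =>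
    (ContinuousLinearMap.apply ℂ ℂ ((1, 0) : ℂ × ℂ)).analyticAt _ |>.comp (hF.fderiv z hz)
  exact h.congr hU fun z hz => (hasDerivAt_cpd1 (hF z hz).differentiableAt).deriv.symm

theorem AnalyticOnNhd.cpd2 {F : ℂ × ℂ → ℂ} {U : Set (ℂ × ℂ)} (hU : IsOpen U)
    (hF : AnalyticOnNhd ℂ F U) : AnalyticOnNhd ℂ (cpd2 F) U := by
  have h : AnalyticOnNhd ℂ (fun z => fderiv ℂ F z (0, 1)) U := fun z hz =>
    (ContinuousLinearMap.apply ℂ ℂ ((0, 1) : ℂ × ℂ)).analyticAt _ |>.comp (hF.fderiv z hz)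
  exact h.congr hU fun z hz => (hasDerivAt_cpd2 (hF z hz).differentiableAt).deriv.symm

theorem AnalyticOnNhd.iterate_cpd1 {F : ℂ × ℂ → ℂ} {U : Set (ℂ × ℂ)} (hU : IsOpen U)
    (hF : AnalyticOnNhd ℂ F U) (n : ℕ) : AnalyticOnNhd ℂ (_root_.cpd1^[n] F) U := by
  induction n with
  | zero => exact hF
  | succ n ih => rw [Function.iterate_succ_apply']; exact ih.cpd1 hU

theorem AnalyticOnNhd.iterate_cpd2 {F : ℂ × ℂ → ℂ} {U : Set (ℂ × ℂ)} (hU : IsOpen U)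
    (hF : AnalyticOnNhd ℂ F U) (n : ℕ) : AnalyticOnNhd ℂ (_root_.cpd2^[n] F) U := by
  induction n with
  | zero => exact hF
  | succ n ih => rw [Function.iterate_succ_apply']; exact ih.cpd2 hU

/-- The embedding `ℝ² ⊆ ℂ²`. -/
def toC (y : ℝ × ℝ) : ℂ × ℂ := (y.1, y.2)

theorem pd1_eq_re {f : ℝ × ℝ → ℝ} {F : ℂ × ℂ → ℂ} {U : Set (ℂ × ℂ)}
    (hF : AnalyticOnNhd ℂ F U) (hU : ∀ y ≠ 0, toC y ∈ U)
    (hf : ∀ y ≠ 0, f y = (F (toC y)).re) : ∀ y ≠ 0, pd1 f y = (cpd1 F (toC y)).re := by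
  intro y hy
  have hd := (hasDerivAt_cpd1 (hF _ (hU y hy)).differentiableAt)
  have h2 : HasDerivAt (fun s : ℝ => (F (s, y.2)).re) _ y.1 := hd.real_of_complex
  have hev : (fun s : ℝ => f (s, y.2)) =ᶠ[nhds y.1] fun s : ℝ => (F (s, y.2)).re := by
    have hc : Continuous fun s : ℝ => (s, y.2) := by fun_prop
    filter_upwards [hc.continuousAt.eventually_ne hy] with s hs using hf _ hs
  rw [pd1, hev.deriv_eq, h2.deriv, cpd1, hd.deriv]

theorem pd2_eq_re {f : ℝ × ℝ → ℝ} {F : ℂ × ℂ → ℂ} {U : Set (ℂ × ℂ)}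
    (hF : AnalyticOnNhd ℂ F U) (hU : ∀ y ≠ 0, toC y ∈ U)
    (hf : ∀ y ≠ 0, f y = (F (toC y)).re) : ∀ y ≠ 0, pd2 f y = (cpd2 F (toC y)).re := by
  intro y hy
  have hd := (hasDerivAt_cpd2 (hF _ (hU y hy)).differentiableAt)
  have h2 : HasDerivAt (fun s : ℝ => (F (y.1, s)).re) _ y.2 := hd.real_of_complex
  have hev : (fun s : ℝ => f (y.1, s)) =ᶠ[nhds y.2] fun s : ℝ => (F (y.1, s)).re := by
    have hc : Continuous fun s : ℝ => (y.1, s) := by fun_prop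
    filter_upwards [hc.continuousAt.eventually_ne hy] with s hs using hf _ hs
  rw [pd2, hev.deriv_eq, h2.deriv, cpd2, hd.deriv]

theorem pdMulti_eq_re {f : ℝ × ℝ → ℝ} {F : ℂ × ℂ → ℂ} {U : Set (ℂ × ℂ)} (hUo : IsOpen U)
    (hF : AnalyticOnNhd ℂ F U) (hU : ∀ y ≠ 0, toC y ∈ U)
    (hf : ∀ y ≠ 0, f y = (F (toC y)).re) (m n : ℕ) :
    ∀ y ≠ 0, pdMulti m n f y = (cpd1^[m] (cpd2^[n] F) (toC y)).re := by
  have h2 : ∀ y ≠ 0, pd2^[n] f y = (cpd2^[n] F (toC y)).re := by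
    induction n with
    | zero => exact hf
    | succ n ih =>
      simp only [Function.iterate_succ_apply']
      exact pd2_eq_re (hF.iterate_cpd2 hUo n) hU ih
  unfold pdMulti
  induction m with
  | zero => exact h2
  | succ m ih =>
    simp only [Function.iterate_succ_apply']
    exact pd1_eq_re ((hF.iterate_cpd2 hUo n).iterate_cpd1 hUo m) hU ih

/-- Cauchy estimates on a polydisc. -/
theorem norm_iterate_cpd_le {F : ℂ × ℂ → ℂ} {U : Set (ℂ × ℂ)} (hUo : IsOpen U)
    (hF : AnalyticOnNhd ℂ F U) {c : ℂ × ℂ} {r M : ℝ} (hr : 0 < r)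
    (hP : Metric.closedBall c r ⊆ U) (hM : ∀ z ∈ Metric.closedBall c r, ‖F z‖ ≤ M) (m n : ℕ) :
    ‖cpd1^[m] (cpd2^[n] F) c‖ ≤ m.factorial * (n.factorial * M / r ^ n) / r ^ m := by
  have hmem : ∀ {s t : ℂ}, s ∈ Metric.closedBall c.1 r → t ∈ Metric.closedBall c.2 r →
      (s, t) ∈ Metric.closedBall c r := fun hs ht => by
    rw [← closedBall_prod_same]; exact ⟨hs, ht⟩
  have hc2 : c.2 ∈ Metric.closedBall c.2 r := Metric.mem_closedBall_self hr.le
  rw [iterate_cpd1]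
  refine Complex.norm_iteratedDeriv_le_of_forall_mem_sphere_norm_le m hr ?_ fun s hs => ?_
  · refine DifferentiableOn.diffContOnCl_ball (U := Metric.closedBall c.1 r) (fun s hs => ?_)
      subset_rfl
    exact (hasDerivAt_cpd1 (z := (s, c.2)) (hF.iterate_cpd2 hUo n _
      (hP (hmem hs hc2))).differentiableAt).differentiableAt.differentiableWithinAt
  · have hs' := Metric.sphere_subset_closedBall hs
    rw [iterate_cpd2]
    refine Complex.norm_iteratedDeriv_le_of_forall_mem_sphere_norm_le n hr ?_ fun t ht =>
      hM _ (hmem hs' (Metric.sphere_subset_closedBall ht))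
    refine DifferentiableOn.diffContOnCl_ball (U := Metric.closedBall c.2 r) (fun t ht => ?_)
      subset_rfl
    exact (hasDerivAt_cpd2 (z := (s, t)) (hF _
      (hP (hmem hs' ht))).differentiableAt).differentiableAt.differentiableWithinAt

/-- The complexification of `|y|²`. -/
def cq (z : ℂ × ℂ) : ℂ := z.1 ^ 2 + z.2 ^ 2

/-- The domain on which the kernel extends holomorphically. -/
def kernelDomain : Set (ℂ × ℂ) := {z | cq z ∈ Complex.slitPlane}

/-- The holomorphic extension of `L(y) / (2π|y|³) · (1 − e^{−|y|²})`. -/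
noncomputable def cKernel (L : ℂ × ℂ → ℂ) (z : ℂ × ℂ) : ℂ :=
  L z / (2 * Real.pi * (cq z ^ (1 / 2 : ℂ)) ^ 3) * (1 - Complex.exp (-cq z))

theorem isOpen_kernelDomain : IsOpen kernelDomain :=
  Complex.isOpen_slitPlane.preimage (by unfold cq; fun_prop)

theorem analyticOnNhd_cKernel {L : ℂ × ℂ → ℂ} (hL : AnalyticOnNhd ℂ L Set.univ) :
    AnalyticOnNhd ℂ (cKernel L) kernelDomain := by
  intro z hz
  have hLz := hL z trivial
  have hq : AnalyticAt ℂ cq z := (analyticAt_fst.pow 2).add (analyticAt_snd.pow 2)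
  have hw : AnalyticAt ℂ (fun z => cq z ^ (1 / 2 : ℂ)) z := hq.cpow analyticAt_const hz
  have hne : 2 * (Real.pi : ℂ) * (cq z ^ (1 / 2 : ℂ)) ^ 3 ≠ 0 := by
    have : cq z ^ (1 / 2 : ℂ) ≠ 0 := by
      simp [Complex.cpow_eq_zero_iff, Complex.slitPlane_ne_zero hz]
    have := Real.pi_ne_zero
    simp_all
  exact (hLz.div (analyticAt_const.mul (hw.pow 3)) hne).mul (analyticAt_const.sub hq.neg.cexp)

theorem nrm_sq (y : ℝ × ℝ) : nrm y ^ 2 = y.1 ^ 2 + y.2 ^ 2 :=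
  Real.sq_sqrt (by positivity)

theorem nrm_pos {y : ℝ × ℝ} (hy : y ≠ 0) : 0 < nrm y := by
  refine Real.sqrt_pos.2 ?_
  by_contra! h
  exact hy (Prod.ext (by simp; nlinarith [sq_nonneg y.1, sq_nonneg y.2])
    (by simp; nlinarith [sq_nonneg y.1, sq_nonneg y.2]))

theorem cq_toC (y : ℝ × ℝ) : cq (toC y) = ((nrm y ^ 2 : ℝ) : ℂ) := by
  rw [nrm_sq]; simp [cq, toC]

theorem toC_mem_kernelDomain {y : ℝ × ℝ} (hy : y ≠ 0) : toC y ∈ kernelDomain := by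
  rw [kernelDomain, Set.mem_ofPred_eq, cq_toC, Complex.ofReal_mem_slitPlane]
  exact pow_pos (nrm_pos hy) 2

theorem cKernel_toC {L : ℂ × ℂ → ℂ} {y : ℝ × ℝ} {l : ℝ} (hl : L (toC y) = l) :
    cKernel L (toC y) =
      ((l / (2 * Real.pi * nrm y ^ 3) * (1 - Real.exp (-(nrm y ^ 2))) : ℝ) : ℂ) := by
  have hw : cq (toC y) ^ (1 / 2 : ℂ) = (nrm y : ℂ) := by
    have h := Complex.ofReal_cpow (sq_nonneg (nrm y)) (1 / 2)
    rw [← Real.sqrt_eq_rpow, Real.sqrt_sq (show 0 ≤ nrm y from Real.sqrt_nonneg _)] at h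
    rw [cq_toC, h]
    norm_num
  rw [cKernel, hw, hl, cq_toC]
  push_cast
  rfl

theorem norm_cq_sub_le {y : ℝ × ℝ} {z : ℂ × ℂ}
    (hz : z ∈ Metric.closedBall (toC y) (nrm y / 20)) :
    ‖cq z - ((nrm y ^ 2 : ℝ) : ℂ)‖ ≤ 9 / 25 * nrm y ^ 2 := by
  have hn : 0 ≤ nrm y := Real.sqrt_nonneg _
  rw [← closedBall_prod_same] at hz
  obtain ⟨h1, h2⟩ := hz
  rw [mem_closedBall_iff_norm] at h1 h2
  have key : ∀ (a : ℝ) (w : ℂ), |a| ≤ nrm y → ‖w - a‖ ≤ nrm y / 20 →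
      ‖w ^ 2 - a ^ 2‖ ≤ 9 / 50 * nrm y ^ 2 := by
    intro a w ha hw
    have h : w ^ 2 - (a : ℂ) ^ 2 = (w - a) * ((w - a) + 2 * a) := by ring
    have hs : ‖(w - a) + 2 * (a : ℂ)‖ ≤ nrm y / 20 + 2 * nrm y := by
      refine (norm_add_le _ _).trans (add_le_add hw ?_)
      simpa using ha
    rw [h, norm_mul]
    calc _ ≤ nrm y / 20 * (nrm y / 20 + 2 * nrm y) := by gcongr
      _ ≤ _ := by nlinarith
  have hy1 : |y.1| ≤ nrm y := Real.abs_le_sqrt (by nlinarith [sq_nonneg y.2])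
  have hy2 : |y.2| ≤ nrm y := Real.abs_le_sqrt (by nlinarith [sq_nonneg y.1])
  have e : cq z - ((nrm y ^ 2 : ℝ) : ℂ) = (z.1 ^ 2 - (y.1 : ℂ) ^ 2) + (z.2 ^ 2 - (y.2 : ℂ) ^ 2) := by
    rw [nrm_sq, cq]; push_cast; ring
  rw [e]
  refine (norm_add_le _ _).trans ?_
  linarith [key _ _ hy1 h1, key _ _ hy2 h2]

theorem re_cq_ge {y : ℝ × ℝ} {z : ℂ × ℂ}
    (hz : z ∈ Metric.closedBall (toC y) (nrm y / 20)) : 16 / 25 * nrm y ^ 2 ≤ (cq z).re := by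
  have h := (Complex.abs_re_le_norm _).trans (norm_cq_sub_le hz)
  rw [Complex.sub_re, Complex.ofReal_re] at h
  linarith [(abs_le.1 h).1]

theorem closedBall_subset_kernelDomain {y : ℝ × ℝ} (hy : y ≠ 0) :
    Metric.closedBall (toC y) (nrm y / 20) ⊆ kernelDomain := fun z hz =>
  Or.inl (lt_of_lt_of_le (by have := nrm_pos hy; positivity) (re_cq_ge hz))

theorem norm_one_sub_exp_neg_le {q : ℂ} (hq : 0 ≤ q.re) :
    ‖1 - Complex.exp (-q)‖ ≤ 2 * ‖q‖ := by
  rcases le_total ‖q‖ 1 with h | h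
  · rw [norm_sub_rev]
    simpa using Complex.norm_exp_sub_one_le (x := -q) (by simpa using h)
  · have h1 : ‖Complex.exp (-q)‖ ≤ 1 := by
      rw [Complex.norm_exp]; simpa using hq
    have := norm_sub_le 1 (Complex.exp (-q))
    rw [norm_one] at this
    linarith

theorem norm_cKernel_le {L : ℂ × ℂ → ℂ} (hL : ∀ z, ‖L z‖ ≤ ‖z‖) {y : ℝ × ℝ} (hy : y ≠ 0)
    {z : ℂ × ℂ} (hz : z ∈ Metric.closedBall (toC y) (nrm y / 20)) : ‖cKernel L z‖ ≤ 1 / 2 := by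
  have hn := nrm_pos hy
  have hre := re_cq_ge hz
  have hexp := norm_one_sub_exp_neg_le (q := cq z) (hre.trans' (by positivity))
  have hq := hre.trans (Complex.re_le_norm _)
  have hy0 : ‖toC y‖ ≤ nrm y := by
    simp only [toC, Prod.norm_def, Complex.norm_real, Real.norm_eq_abs]
    exact max_le (Real.abs_le_sqrt (by nlinarith [sq_nonneg y.2]))
      (Real.abs_le_sqrt (by nlinarith [sq_nonneg y.1]))
  have hz0 : ‖L z‖ ≤ 21 / 20 * nrm y := by
    have h1 := norm_sub_norm_le z (toC y)
    have h2 := mem_closedBall_iff_norm.1 hz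
    linarith [hL z]
  set w := cq z ^ (1 / 2 : ℂ) with hw
  have hw2 : ‖w‖ ^ 2 = ‖cq z‖ := by
    rw [← norm_pow, hw, ← Complex.cpow_nat_mul]
    norm_num
  have hwn : 4 / 5 * nrm y ≤ ‖w‖ := by
    refine le_of_sq_le_sq ?_ (norm_nonneg _)
    rw [hw2]; linarith
  have hw0 : 0 < ‖w‖ := lt_of_lt_of_le (by positivity) hwn
  have hpi := Real.pi_gt_three
  rw [cKernel, norm_mul, norm_div, norm_mul, norm_mul, norm_pow, Complex.norm_real,
    Real.norm_of_nonneg Real.pi_pos.le, Complex.norm_two]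
  rw [← hw2] at hexp
  calc _ ≤ 21 / 20 * nrm y / (2 * Real.pi * ‖w‖ ^ 3) * (2 * ‖w‖ ^ 2) := by gcongr
    _ = 21 / 20 * nrm y / (Real.pi * ‖w‖) := by field_simp
    _ ≤ 1 / 2 := by
      rw [div_le_iff₀ (by positivity)]
      nlinarith

theorem abs_pdMulti_le {f : ℝ × ℝ → ℝ} {L : ℂ × ℂ → ℂ} (hLa : AnalyticOnNhd ℂ L Set.univ)
    (hL : ∀ z, ‖L z‖ ≤ ‖z‖) (hf : ∀ y, f y = (cKernel L (toC y)).re) (m n : ℕ)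
    {y : ℝ × ℝ} (hy : y ≠ 0) :
    |pdMulti m n f y| ≤ 1 / 2 * (20 ^ (m + n) * (m + n).factorial / nrm y ^ (m + n)) := by
  have hn := nrm_pos hy
  have hF := analyticOnNhd_cKernel hLa
  rw [pdMulti_eq_re isOpen_kernelDomain hF (fun y => toC_mem_kernelDomain) (fun y _ => hf y) m n
    y hy]
  refine (Complex.abs_re_le_norm _).trans ((norm_iterate_cpd_le isOpen_kernelDomain hF
    (by positivity) (closedBall_subset_kernelDomain hy) (fun z => norm_cKernel_le hL hy)
    m n).trans ?_)
  have hfac : (m.factorial * n.factorial : ℝ) ≤ (m + n).factorial := by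
    exact_mod_cast Nat.le_of_dvd (Nat.factorial_pos _)
      (Nat.factorial_mul_factorial_dvd_factorial_add m n)
  calc _ = 1 / 2 * (20 ^ (m + n) * (m.factorial * n.factorial) / nrm y ^ (m + n)) := by
        rw [div_pow, div_pow, pow_add, pow_add]; field_simp
    _ ≤ _ := by gcongr

/-- Derivative bounds for the outer SQG kernel `K_out`. -/
theorem Kout_derivative_bounds :
    ∃ C_K : ℝ, 1 ≤ C_K ∧ ∀ (α₁ α₂ : ℕ) (y : ℝ × ℝ), y ≠ 0 →
      Real.sqrt ((pdMulti α₁ α₂ Kout1 y) ^ 2 + (pdMulti α₁ α₂ Kout2 y) ^ 2) ≤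
        C_K ^ (α₁ + α₂) * ((α₁ + α₂).factorial : ℝ) / nrm y ^ (α₁ + α₂) := by
  refine ⟨20, by norm_num, fun m n y hy => ?_⟩
  have hn := nrm_pos hy
  have h1 : |pdMulti m n Kout1 y| ≤ _ :=
    abs_pdMulti_le (L := fun z => -z.2) (fun z _ => analyticAt_snd.neg)
      (fun z => (norm_neg z.2).trans_le (norm_snd_le z))
      (fun y => by rw [cKernel_toC (l := -y.2) (by simp [toC]), Complex.ofReal_re]; rfl) m n hy
  have h2 : |pdMulti m n Kout2 y| ≤ _ :=
    abs_pdMulti_le (L := fun z => z.1) (fun z _ => analyticAt_fst) norm_fst_le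
      (fun y => by rw [cKernel_toC (l := y.1) rfl, Complex.ofReal_re]; rfl) m n hy
  set B : ℝ := 20 ^ (m + n) * (m + n).factorial / nrm y ^ (m + n)
  have hB : 0 ≤ B := by positivity
  refine Real.sqrt_le_iff.2 ⟨hB, ?_⟩
  nlinarith [sq_le_sq' (neg_le_of_abs_le h1) (le_of_abs_le h1),
    sq_le_sq' (neg_le_of_abs_le h2) (le_of_abs_le h2)]
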